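/- Let Ω be a pattern space that is L-sub with subdivision S and substitution σ = S ∘ L. Then for every n ∈ ℕ, Ω is Lⁿ-sub with subdivision the composite S₀ ∘ S₁ ∘ … ∘ S_{n−1} of the distorted subdivision maps S_i := Lⁱ ∘ S ∘ L⁻ⁱ : L^{i+1}Ω → LⁱΩ, and the corresponding substitution is σⁿ. If Ω contains only finitely many LI-classes, then there exists n ∈ ℕ such that σⁿ maps each LI-class of Ω to itself, and then every element of Ω is an Lⁿ-sub pattern. Moreover, if Ω is FLC and well-separated and L is expansive, then Ω contains only finitely many LI-classes. -/

import Mathlib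

open Metric Set Filter Topology Pointwise

variable {E : Type*} [NormedAddCommGroup E] [NormedSpace ℝ E] {S : Type*}

/-- Equality of the `U`-patches of the pattern `P` at `x` and of `Q` at `y`:
`P[x,U] = Q[y,U]`. -/
def PatchEq (P Q : E → S) (x y : E) (U : Set E) : Prop :=
  ∀ u ∈ U, P (x + u) = Q (y + u)

/-- The translate `P + z` of a pattern `P`. -/
def transl (z : E) (P : E → S) : E → S := fun x => P (x - z)

/-- The distortion `L P` of a pattern `P` by a linear automorphism `L`. -/
def distort (L : E ≃ₗ[ℝ] E) (P : E → S) : E → S := fun x => P (L.symm x)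

/-- `Q` is locally indistinguishable from `P` (`Q ≼ P`). -/
def LIfrom (Q P : E → S) : Prop :=
  ∀ U : Set E, IsCompact U → ∀ x : E, ∃ y : E, PatchEq Q P x y U

/-- `P` and `Q` are locally isomorphic (`P ≈ Q`). -/
def LocIso (P Q : E → S) : Prop :=
  LIfrom P Q ∧ LIfrom Q P

/-- `Q` is locally derivable from `P` (`P ⊳ Q`). -/
def LD (P Q : E → S) : Prop :=
  ∃ c : ℝ, 0 ≤ c ∧ ∀ x y : E, PatchEq P P x y (closedBall 0 c) → Q x = Q y

/-- The group of translational periods of a pattern: `{g | P + g = P}`. -/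
def periods (P : E → S) : AddSubgroup E where
  carrier := {g : E | ∀ x : E, P (x + g) = P x}
  zero_mem' := by intro x; rw [add_zero]
  add_mem' := by
    intro a b ha hb
    simp only [Set.mem_setOf_eq] at ha hb ⊢
    intro x
    rw [← add_assoc, hb, ha]
  neg_mem' := by
    intro a ha
    simp only [Set.mem_setOf_eq] at ha ⊢
    intro x
    have h := ha (x + -a)
    have h2 : x + -a + a = x := by abel
    rw [h2] at h
    exact h.symm

/-- Finite local complexity (FLC) for a single pattern. -/
def IsFLC (P : E → S) : Prop :=
  ∀ U : Set E, IsCompact U → ∃ K : Set E, IsCompact K ∧ ∀ x : E, ∃ v ∈ K, PatchEq P P x v U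

/-- Repetitivity for a single pattern. -/
def Repetitive (P : E → S) : Prop :=
  ∀ U : Set E, IsCompact U →
    ∃ R : Set E, IsCompact R ∧ ∀ x y : E, ∃ v ∈ R, PatchEq P P x (y + v) U

/-- Well-separation for a single pattern. -/
def WellSeparated (P : E → S) : Prop :=
  ∃ V : Set E, IsCompact V ∧ ∀ x y : E, P x ≠ P y →
    ∃ B ∈ 𝓝 (0 : E), ∀ b ∈ B, ∀ b' ∈ B, ¬ PatchEq P P (x + b) (y + b') V

/-- Return discreteness for a single pattern. -/
def ReturnDiscrete (P : E → S) : Prop :=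
  ∃ B ∈ 𝓝 (0 : E), ∃ V : Set E, IsCompact V ∧
    ∀ x : E, ∀ b ∈ B, PatchEq P P x (x + b) V → b = 0

/-- The translational hull of a pattern: all patterns locally indistinguishable from it. -/
def patternHull (P : E → S) : Set (E → S) := {Q | LIfrom Q P}

/-- A pattern space: a nonempty set of patterns closed under being locally
indistinguishable from the collection. -/
def IsPatternSpace (Ω : Set (E → S)) : Prop :=
  Ω.Nonempty ∧ ∀ Q : E → S,
    (∀ U : Set E, IsCompact U → ∀ x : E, ∃ R ∈ Ω, ∃ y : E, PatchEq Q R x y U) → Q ∈ Ω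

/-- Finite local complexity for a pattern space. -/
def IsFLCSpace (Ω : Set (E → S)) : Prop :=
  ∀ U : Set E, IsCompact U → ∃ (n : ℕ) (Ps : Fin n → E → S) (Ks : Fin n → Set E),
    (∀ i, IsCompact (Ks i)) ∧ ∀ Q ∈ Ω, ∀ x : E, ∃ i, ∃ y ∈ Ks i, PatchEq Q (Ps i) x y U

/-- Well-separation for a pattern space. -/
def WellSeparatedSpace (Ω : Set (E → S)) : Prop :=
  ∃ V : Set E, IsCompact V ∧ ∀ P ∈ Ω, ∀ Q ∈ Ω, P 0 ≠ Q 0 →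
    ∃ B ∈ 𝓝 (0 : E), ∀ b ∈ B, ∀ b' ∈ B, ¬ PatchEq P Q b b' V

/-- Return discreteness for a pattern space. -/
def ReturnDiscreteSpace (Ω : Set (E → S)) : Prop :=
  ∃ B ∈ 𝓝 (0 : E), ∃ V : Set E, IsCompact V ∧
    ∀ P ∈ Ω, ∀ b ∈ B, PatchEq P P 0 b V → b = 0

/-- Repetitivity for a pattern space. -/
def RepetitiveSpace (Ω : Set (E → S)) : Prop :=
  ∀ U : Set E, IsCompact U → ∃ R : Set E, IsCompact R ∧
    ∀ P ∈ Ω, ∀ Q ∈ Ω, ∃ v ∈ R, PatchEq P Q 0 v U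

/-- A local derivation (LD) map between two sets of patterns. -/
def IsLDMapOn (f : (E → S) → (E → S)) (Ω Ω' : Set (E → S)) : Prop :=
  Set.MapsTo f Ω Ω' ∧ ∃ c : ℝ, 0 ≤ c ∧
    ∀ P ∈ Ω, ∀ Q ∈ Ω, ∀ x y : E, PatchEq P Q x y (closedBall 0 c) → f P x = f Q y

/-- An expansive linear automorphism (all eigenvalues of modulus strictly greater
than `1`; equivalently, iterates expand uniformly at an exponential rate). -/
def IsExpansive (L : E ≃ₗ[ℝ] E) : Prop :=
  ∃ C > (0 : ℝ), ∃ l > (1 : ℝ), ∀ (n : ℕ) (x : E), C * l ^ n * ‖x‖ ≤ ‖(L ^ n : E ≃ₗ[ℝ] E) x‖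

/-- `P` is `L`-sub with predecessor `P'`: `P' ≼ P` and `L P' ⊳ P`. -/
def IsLSub (L : E ≃ₗ[ℝ] E) (P P' : E → S) : Prop :=
  LIfrom P' P ∧ LD (distort L P') P

/-- An `L`-sub pattern space: `Ω` together with a surjective LD (subdivision) map
`S : L Ω → Ω`. -/
def IsLSubSpace (L : E ≃ₗ[ℝ] E) (Ω : Set (E → S)) (Sub : (E → S) → (E → S)) : Prop :=
  IsLDMapOn Sub (distort L '' Ω) Ω ∧ Set.SurjOn Sub (distort L '' Ω) Ω

/-- The substitution map `σ := S ∘ L`. -/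
def substMap (L : E ≃ₗ[ℝ] E) (Sub : (E → S) → (E → S)) : (E → S) → (E → S) :=
  fun Q => Sub (distort L Q)


/-- The composite `S₀ ∘ S₁ ∘ ⋯ ∘ S_{n-1}` of the distorted subdivision maps
`S_i := L^i ∘ S ∘ L^{-i}`. -/
def iterSub (L : E ≃ₗ[ℝ] E) (Sub : (E → S) → (E → S)) : ℕ → (E → S) → (E → S)
  | 0 => id
  | n + 1 => fun Q => iterSub L Sub n (distort (L ^ n) (Sub (distort (L ^ n)⁻¹ Q)))

/-- `Ω` contains only finitely many LI-classes. -/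
def FinitelyManyLIClasses (Ω : Set (E → S)) : Prop :=
  ∃ T : Finset (E → S), ↑T ⊆ Ω ∧ ∀ P ∈ Ω, ∃ Q ∈ T, LocIso P Q

set_option linter.unusedSectionVars false

section PatchEq

theorem PatchEq.mono {P Q : E → S} {x y : E} {U V : Set E} (h : PatchEq P Q x y V)
    (hUV : U ⊆ V) : PatchEq P Q x y U := fun u hu => h u (hUV hu)

theorem PatchEq.symm {P Q : E → S} {x y : E} {U : Set E} (h : PatchEq P Q x y U) :
    PatchEq Q P y x U := fun u hu => (h u hu).symm

theorem PatchEq.trans {P Q R : E → S} {x y z : E} {U : Set E} (h : PatchEq P Q x y U)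
    (h' : PatchEq Q R y z U) : PatchEq P R x z U := fun u hu => (h u hu).trans (h' u hu)

theorem PatchEq.shift {P Q : E → S} {x y d : E} {r s : ℝ}
    (h : PatchEq P Q x y (closedBall 0 r)) (hd : ‖d‖ + s ≤ r) :
    PatchEq P Q (x + d) (y + d) (closedBall 0 s) := by
  intro u hu
  rw [add_assoc, add_assoc]
  apply h
  rw [mem_closedBall_zero_iff] at hu ⊢
  linarith [norm_add_le d u]

end PatchEq

section LocIso

theorem LIfrom.refl (P : E → S) : LIfrom P P := fun _ _ x => ⟨x, fun _ _ => rfl⟩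

theorem LIfrom.trans {P Q R : E → S} (h : LIfrom P Q) (h' : LIfrom Q R) : LIfrom P R := by
  intro U hU x
  obtain ⟨y, hy⟩ := h U hU x
  obtain ⟨z, hz⟩ := h' U hU y
  exact ⟨z, hy.trans hz⟩

theorem LocIso.refl (P : E → S) : LocIso P P := ⟨.refl P, .refl P⟩

theorem LocIso.symm {P Q : E → S} (h : LocIso P Q) : LocIso Q P := ⟨h.2, h.1⟩

theorem LocIso.trans {P Q R : E → S} (h : LocIso P Q) (h' : LocIso Q R) : LocIso P R :=
  ⟨h.1.trans h'.1, h'.2.trans h.2⟩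

end LocIso

section Subdivision

variable {L : E ≃ₗ[ℝ] E} {Ω : Set (E → S)} {Sub : (E → S) → (E → S)}

theorem patchEq_distort_iff (L : E ≃ₗ[ℝ] E) {P Q : E → S} {x y : E} {U : Set E} :
    PatchEq (distort L P) (distort L Q) x y U ↔
      PatchEq P Q (L.symm x) (L.symm y) (L.symm '' U) := by
  simp [PatchEq, distort]

theorem IsLSubSpace.mapsTo_substMap (h : IsLSubSpace L Ω Sub) :
    MapsTo (substMap L Sub) Ω Ω := fun _ hP => h.1.1 (mem_image_of_mem _ hP)

theorem IsLSubSpace.surjOn_substMap (h : IsLSubSpace L Ω Sub) :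
    SurjOn (substMap L Sub) Ω Ω := by
  intro P hP
  obtain ⟨_, ⟨Q, hQ, rfl⟩, rfl⟩ := h.2 hP
  exact ⟨Q, hQ, rfl⟩

theorem IsLSubSpace.exists_radius (h : IsLSubSpace L Ω Sub) :
    ∃ c : ℝ, 0 ≤ c ∧ ∀ P ∈ Ω, ∀ Q ∈ Ω, ∀ x y : E,
      PatchEq (distort L P) (distort L Q) x y (closedBall 0 c) →
        substMap L Sub P x = substMap L Sub Q y := by
  obtain ⟨c, hc, H⟩ := h.1.2
  exact ⟨c, hc, fun P hP Q hQ => H _ (mem_image_of_mem _ hP) _ (mem_image_of_mem _ hQ)⟩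

theorem substMap_iterSub (L : E ≃ₗ[ℝ] E) (Sub : (E → S) → (E → S)) (n : ℕ) (Q : E → S) :
    substMap (L ^ n) (iterSub L Sub n) Q = (substMap L Sub)^[n] Q := by
  induction n generalizing Q with
  | zero => rfl
  | succ n ih =>
    have key : distort (L ^ n)⁻¹ (distort (L ^ (n + 1)) Q) = distort L Q := by
      funext x
      have hx : (L ^ (n + 1)).symm ((L ^ n) x) = L.symm x := by
        rw [LinearEquiv.symm_apply_eq, pow_succ, LinearEquiv.mul_apply,
          LinearEquiv.apply_symm_apply]
      exact congrArg Q hx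
    rw [Function.iterate_succ_apply, ← ih]
    change iterSub L Sub n (distort (L ^ n) (Sub (distort (L ^ n)⁻¹ (distort (L ^ (n + 1)) Q)))) = _
    rw [key]
    rfl

variable [FiniteDimensional ℝ E]

theorem isCompact_image_linearEquiv (L : E ≃ₗ[ℝ] E) {U : Set E} (hU : IsCompact U) :
    IsCompact (L '' U) :=
  hU.image (LinearMap.continuous_of_finiteDimensional (L : E →ₗ[ℝ] E))

theorem IsLSubSpace.exists_compact_patchEq (h : IsLSubSpace L Ω Sub) {U : Set E}
    (hU : IsCompact U) :
    ∃ V : Set E, IsCompact V ∧ ∀ P ∈ Ω, ∀ Q ∈ Ω, ∀ x y : E,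
      PatchEq P Q x y V → PatchEq (substMap L Sub P) (substMap L Sub Q) (L x) (L y) U := by
  have : ProperSpace E := FiniteDimensional.proper_real E
  obtain ⟨c, -, H⟩ := h.exists_radius
  refine ⟨L.symm '' (U + closedBall 0 c),
    isCompact_image_linearEquiv _ (hU.add (isCompact_closedBall 0 c)), ?_⟩
  intro P hP Q hQ x y hPQ u hu
  apply H P hP Q hQ
  intro v hv
  simp only [distort, map_add, LinearEquiv.symm_apply_apply, add_assoc]
  rw [← map_add]
  exact hPQ _ (mem_image_of_mem _ (add_mem_add hu hv))

theorem IsLSubSpace.liFrom_substMap (h : IsLSubSpace L Ω Sub) {P Q : E → S} (hP : P ∈ Ω)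
    (hQ : Q ∈ Ω) (hPQ : LIfrom P Q) : LIfrom (substMap L Sub P) (substMap L Sub Q) := by
  intro U hU x
  obtain ⟨V, hV, H⟩ := h.exists_compact_patchEq hU
  obtain ⟨y, hy⟩ := hPQ V hV (L.symm x)
  refine ⟨L y, ?_⟩
  simpa using H P hP Q hQ _ _ hy

theorem IsLSubSpace.locIso_substMap (h : IsLSubSpace L Ω Sub) {P Q : E → S} (hP : P ∈ Ω)
    (hQ : Q ∈ Ω) (hPQ : LocIso P Q) : LocIso (substMap L Sub P) (substMap L Sub Q) :=
  ⟨h.liFrom_substMap hP hQ hPQ.1, h.liFrom_substMap hQ hP hPQ.2⟩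

theorem IsLSubSpace.exists_radius_iterate (h : IsLSubSpace L Ω Sub) (n : ℕ) :
    ∃ c : ℝ, 0 ≤ c ∧ ∀ P ∈ Ω, ∀ Q ∈ Ω, ∀ x y : E,
      PatchEq (distort (L ^ n) P) (distort (L ^ n) Q) x y (closedBall 0 c) →
        (substMap L Sub)^[n] P x = (substMap L Sub)^[n] Q y := by
  have : ProperSpace E := FiniteDimensional.proper_real E
  induction n with
  | zero =>
    refine ⟨0, le_rfl, fun P _ Q _ x y hPQ => ?_⟩
    have h0 := hPQ 0 (by simp)
    rwa [add_zero, add_zero] at h0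
  | succ n ih =>
    obtain ⟨c, -, H⟩ := ih
    obtain ⟨V, hV, HV⟩ := h.exists_compact_patchEq
      (isCompact_image_linearEquiv (L ^ n).symm (isCompact_closedBall 0 c))
    obtain ⟨r, hr, hVr⟩ :=
      (isCompact_image_linearEquiv (L ^ (n + 1)) hV).isBounded.subset_closedBall_lt 0 0
    refine ⟨r, hr.le, fun P hP Q hQ x y hPQ => ?_⟩
    rw [Function.iterate_succ_apply, Function.iterate_succ_apply]
    apply H _ (h.mapsTo_substMap hP) _ (h.mapsTo_substMap hQ)
    rw [patchEq_distort_iff]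
    have hL (z : E) : L ((L ^ (n + 1)).symm z) = (L ^ n).symm z := by
      rw [LinearEquiv.eq_symm_apply, ← LinearEquiv.mul_apply, ← pow_succ,
        LinearEquiv.apply_symm_apply]
    rw [← hL, ← hL]
    apply HV P hP Q hQ
    refine ((patchEq_distort_iff _).1 hPQ).mono fun v hv => ?_
    exact ⟨(L ^ (n + 1)) v, hVr (mem_image_of_mem _ hv), LinearEquiv.symm_apply_apply _ _⟩

theorem IsLSubSpace.iterate (h : IsLSubSpace L Ω Sub) (n : ℕ) :
    IsLSubSpace (L ^ n) Ω (iterSub L Sub n) := by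
  have hit (Q : E → S) : iterSub L Sub n (distort (L ^ n) Q) = (substMap L Sub)^[n] Q :=
    substMap_iterSub L Sub n Q
  refine ⟨⟨?_, ?_⟩, ?_⟩
  · rintro _ ⟨P, hP, rfl⟩
    rw [hit]
    exact h.mapsTo_substMap.iterate n hP
  · obtain ⟨c, hc, H⟩ := h.exists_radius_iterate n
    refine ⟨c, hc, ?_⟩
    rintro _ ⟨P, hP, rfl⟩ _ ⟨Q, hQ, rfl⟩ x y hPQ
    rw [hit, hit]
    exact H P hP Q hQ x y hPQ
  · intro P hP
    obtain ⟨Q, hQ, rfl⟩ := h.surjOn_substMap.iterate n hP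
    exact ⟨_, mem_image_of_mem _ hQ, hit Q⟩

end Subdivision

section FiniteClasses

variable {L : E ≃ₗ[ℝ] E} {Ω : Set (E → S)} {Sub : (E → S) → (E → S)}

/-- Local isomorphism as an equivalence relation on a set of patterns. -/
def locIsoSetoid (Ω : Set (E → S)) : Setoid Ω where
  r P Q := LocIso P.1 Q.1
  iseqv := ⟨fun P => .refl P.1, .symm, .trans⟩

theorem FinitelyManyLIClasses.finite_quotient (h : FinitelyManyLIClasses Ω) :
    Finite (Quotient (locIsoSetoid Ω)) := by
  obtain ⟨T, hT, H⟩ := h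
  refine Finite.of_surjective
    (fun t : T => (Quotient.mk (locIsoSetoid Ω) ⟨t.1, hT t.2⟩)) fun q => ?_
  induction q using Quotient.inductionOn with
  | h P =>
    obtain ⟨Q, hQ, hPQ⟩ := H P.1 P.2
    exact ⟨⟨Q, hQ⟩, Quotient.sound hPQ.symm⟩

theorem IsLSubSpace.exists_iterate_locIso [FiniteDimensional ℝ E] (h : IsLSubSpace L Ω Sub)
    (hfin : FinitelyManyLIClasses Ω) :
    ∃ n : ℕ, 0 < n ∧ ∀ P ∈ Ω, LocIso ((substMap L Sub)^[n] P) P := by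
  have := hfin.finite_quotient
  let f : Ω → Ω := h.mapsTo_substMap.restrict
  let g : Quotient (locIsoSetoid Ω) → Quotient (locIsoSetoid Ω) :=
    Quotient.map f fun P Q hPQ => h.locIso_substMap P.2 Q.2 hPQ
  have hg : Function.Surjective g := by
    intro q
    induction q using Quotient.inductionOn with
    | h P =>
      obtain ⟨Q, hQ, hQP⟩ := h.surjOn_substMap P.2
      exact ⟨Quotient.mk _ ⟨Q, hQ⟩, congrArg (Quotient.mk _) (Subtype.ext hQP)⟩
  let e : Equiv.Perm (Quotient (locIsoSetoid Ω)) :=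
    Equiv.ofBijective g ⟨Finite.injective_iff_surjective.2 hg, hg⟩
  have hiter (n : ℕ) (P : Ω) :
      g^[n] (Quotient.mk _ P) =
        Quotient.mk _ ⟨(substMap L Sub)^[n] P.1, h.mapsTo_substMap.iterate n P.2⟩ := by
    induction n generalizing P with
    | zero => rfl
    | succ n ih => exact ih (f P)
  refine ⟨orderOf e, orderOf_pos e, fun P hP => ?_⟩
  have h1 : g^[orderOf e] = id := by
    have := Equiv.Perm.iterate_eq_pow e (orderOf e)
    rw [pow_orderOf_eq_one] at this
    exact this
  have h2 := hiter (orderOf e) ⟨P, hP⟩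
  rw [h1] at h2
  exact (Quotient.exact h2 : LocIso _ _).symm

theorem finitelyManyLIClasses_of_finite_invariant {α : Type*} [Finite α] (g : (E → S) → α)
    (hg : ∀ P ∈ Ω, ∀ Q ∈ Ω, g P = g Q → LIfrom P Q) : FinitelyManyLIClasses Ω := by
  obtain ⟨T, hT, hbij⟩ := Set.exists_subset_bijOn Ω g
  have hfin : T.Finite := Set.Finite.of_finite_image (Set.toFinite _) hbij.injOn
  refine ⟨hfin.toFinset, by simpa using hT, fun P hP => ?_⟩
  obtain ⟨Q, hQ, hQP⟩ := hbij.surjOn (mem_image_of_mem g hP)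
  exact ⟨Q, by simpa using hQ, hg _ hP _ (hT hQ) hQP.symm, hg _ (hT hQ) _ hP hQP⟩

/-- In an FLC space, finitely many patches of a given radius occur near every point. -/
theorem IsFLCSpace.exists_finite_patches [FiniteDimensional ℝ E] (h : IsFLCSpace Ω) (r : ℝ) :
    ∃ F : Set ((E → S) × E), F.Finite ∧ ∀ Q ∈ Ω, ∀ x : E, ∃ p ∈ F, ∃ d : E, ‖d‖ ≤ 1 ∧
      PatchEq Q p.1 (x + d) p.2 (closedBall 0 r) := by
  have : ProperSpace E := FiniteDimensional.proper_real E
  obtain ⟨n, Ps, Ks, hK, H⟩ := h (closedBall 0 (r + 1)) (isCompact_closedBall _ _)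
  choose t _ htfin hcover using fun i => (hK i).finite_cover_balls one_pos
  refine ⟨⋃ i, (fun y => (Ps i, y)) '' t i,
    Set.finite_iUnion fun i => (htfin i).image _, fun Q hQ x => ?_⟩
  obtain ⟨i, y, hy, hpatch⟩ := H Q hQ x
  obtain ⟨z, hz, hyz⟩ := mem_iUnion₂.1 (hcover i hy)
  have hd : ‖z - y‖ ≤ 1 := by
    rw [← dist_eq_norm, dist_comm]
    exact (mem_ball.1 hyz).le
  refine ⟨(Ps i, z), mem_iUnion.2 ⟨i, mem_image_of_mem _ hz⟩, z - y, hd, ?_⟩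
  have := hpatch.shift (d := z - y) (s := r) (by linarith)
  rwa [add_sub_cancel] at this

theorem IsExpansive.exists_pow_two_mul_norm_le (h : IsExpansive L) :
    ∃ m : ℕ, ∀ x : E, 2 * ‖x‖ ≤ ‖(L ^ m) x‖ := by
  obtain ⟨C, hC, l, hl, H⟩ := h
  obtain ⟨m, hm⟩ := pow_unbounded_of_one_lt (2 / C) hl
  refine ⟨m, fun x => le_trans ?_ (H m x)⟩
  gcongr
  rw [div_lt_iff₀' hC] at hm
  exact hm.le

theorem patchEq_iterate_substMap {c : ℝ} (hmaps : MapsTo (substMap L Sub) Ω Ω)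
    (hL : ∀ x : E, 2 * ‖x‖ ≤ ‖L x‖)
    (hc : ∀ P ∈ Ω, ∀ Q ∈ Ω, ∀ x y : E,
      PatchEq (distort L P) (distort L Q) x y (closedBall 0 c) →
        substMap L Sub P x = substMap L Sub Q y)
    {P Q : E → S} (hP : P ∈ Ω) (hQ : Q ∈ Ω) {x y : E}
    (hPQ : PatchEq P Q x y (closedBall 0 (c + 1))) (k : ℕ) :
    PatchEq ((substMap L Sub)^[k] P) ((substMap L Sub)^[k] Q) ((L ^ k) x) ((L ^ k) y)
      (closedBall 0 (c + 2 ^ k)) := by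
  induction k with
  | zero => simpa using hPQ
  | succ k ih =>
    rw [Function.iterate_succ_apply', Function.iterate_succ_apply', pow_succ' L,
      LinearEquiv.mul_apply, LinearEquiv.mul_apply]
    intro u hu
    apply hc _ (hmaps.iterate k hP) _ (hmaps.iterate k hQ)
    intro v hv
    simp only [distort, map_add, LinearEquiv.symm_apply_apply, add_assoc]
    rw [← map_add]
    apply ih
    rw [mem_closedBall_zero_iff] at hu hv ⊢
    have h1 := hL (L.symm (u + v))
    rw [LinearEquiv.apply_symm_apply] at h1
    rw [pow_succ] at hu
    linarith [norm_add_le u v]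

theorem IsLSubSpace.finitelyManyLIClasses_of_two_mul_norm_le [FiniteDimensional ℝ E]
    (h : IsLSubSpace L Ω Sub) (hflc : IsFLCSpace Ω) (hL : ∀ x : E, 2 * ‖x‖ ≤ ‖L x‖) :
    FinitelyManyLIClasses Ω := by
  obtain ⟨c, -, hc⟩ := h.exists_radius
  obtain ⟨F, hF, HF⟩ := hflc.exists_finite_patches (c + 2)
  have : Finite F := hF
  have hpred (k : ℕ) (Q : E → S) : ∃ Q' : E → S, Q ∈ Ω → Q' ∈ Ω ∧ (substMap L Sub)^[k] Q' = Q := by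
    by_cases hQ : Q ∈ Ω
    · obtain ⟨Q', hQ', e⟩ := h.surjOn_substMap.iterate k hQ
      exact ⟨Q', fun _ => ⟨hQ', e⟩⟩
    · exact ⟨Q, fun hQ' => absurd hQ' hQ⟩
  choose pre hpre using hpred
  let occurs (k : ℕ) (Q : E → S) (p : F) : Prop :=
    ∃ z : E, PatchEq (pre k Q) p.1.1 z p.1.2 (closedBall 0 (c + 2))
  -- The patches occurring in `pre k Q` for ultrafilter-many `k` determine the class of `Q`.
  refine finitelyManyLIClasses_of_finite_invariant
    (fun Q => {p : F | ∀ᶠ k in (hyperfilter ℕ : Filter ℕ), occurs k Q p}) fun P hP Q hQ hPQ => ?_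
  have himp : ∀ᶠ k in (hyperfilter ℕ : Filter ℕ), ∀ p : F, occurs k P p → occurs k Q p := by
    rw [eventually_all]
    intro p
    by_cases hp : ∀ᶠ k in (hyperfilter ℕ : Filter ℕ), occurs k P p
    · have : ∀ᶠ k in (hyperfilter ℕ : Filter ℕ), occurs k Q p := (Set.ext_iff.1 hPQ p).1 hp
      exact this.mono fun k hk _ => hk
    · rw [← Ultrafilter.eventually_not] at hp
      exact hp.mono fun k hk hk' => absurd hk' hk
  intro U hU x
  obtain ⟨r, hUr⟩ := hU.isBounded.subset_closedBall 0
  have hlarge : ∀ᶠ k : ℕ in (hyperfilter ℕ : Filter ℕ), r ≤ c + 2 ^ k := by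
    have : Tendsto (fun k : ℕ => c + (2 : ℝ) ^ k) atTop atTop :=
      tendsto_atTop_add_const_left _ _ (tendsto_pow_atTop_atTop_of_one_lt one_lt_two)
    exact Filter.Eventually.filter_mono Nat.hyperfilter_le_atTop (this.eventually_ge_atTop r)
  obtain ⟨k, hk, hrk⟩ := (himp.and hlarge).exists
  obtain ⟨hP', eP⟩ := hpre k P hP
  obtain ⟨hQ', eQ⟩ := hpre k Q hQ
  obtain ⟨p, hp, d, hd, hpatch⟩ := HF _ hP' ((L ^ k).symm x)
  obtain ⟨z, hz⟩ := hk ⟨p, hp⟩ ⟨_, hpatch⟩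
  have hshift := (hpatch.trans hz.symm).shift (d := -d) (s := c + 1) (by rw [norm_neg]; linarith)
  rw [add_neg_cancel_right] at hshift
  have := patchEq_iterate_substMap h.mapsTo_substMap hL hc hP' hQ' hshift k
  rw [eP, eQ, LinearEquiv.apply_symm_apply] at this
  exact ⟨_, this.mono (hUr.trans (closedBall_subset_closedBall hrk))⟩

end FiniteClasses

/-- Theorem: an `L`-sub pattern space is `Lⁿ`-sub for every `n`, with subdivision the
composite of the distorted subdivision maps and substitution `σⁿ`; if it has finitely
many LI-classes then some power of substitution fixes LI-classes and every element is
an `Lⁿ`-sub pattern; FLC, well-separated spaces with `L` expansive have finitely many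
LI-classes. -/
theorem stmt7 [FiniteDimensional ℝ E] (L : E ≃ₗ[ℝ] E)
    (Ω : Set (E → S)) (hΩ : IsPatternSpace Ω)
    (Sub : (E → S) → (E → S)) (hSub : IsLSubSpace L Ω Sub) :
    (∀ n : ℕ, IsLSubSpace (L ^ n) Ω (iterSub L Sub n) ∧
      ∀ Q : E → S, substMap (L ^ n) (iterSub L Sub n) Q = (substMap L Sub)^[n] Q) ∧
    (FinitelyManyLIClasses Ω →
      ∃ n : ℕ, 0 < n ∧ (∀ P ∈ Ω, LocIso ((substMap L Sub)^[n] P) P) ∧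
        ∀ P ∈ Ω, ∃ P' : E → S, LIfrom P' P ∧ LD (distort (L ^ n) P') P) ∧
    (IsFLCSpace Ω → WellSeparatedSpace Ω → IsExpansive L →
      FinitelyManyLIClasses Ω) := by
  refine ⟨fun n => ⟨hSub.iterate n, substMap_iterSub L Sub n⟩, fun hfin => ?_, ?_⟩
  · obtain ⟨n, hn, hiso⟩ := hSub.exists_iterate_locIso hfin
    refine ⟨n, hn, hiso, fun P hP => ?_⟩
    obtain ⟨Q, hQ, rfl⟩ := hSub.surjOn_substMap.iterate n hP
    obtain ⟨c, hc, H⟩ := hSub.exists_radius_iterate n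
    exact ⟨Q, (hiso Q hQ).2, c, hc, H Q hQ Q hQ⟩
  · intro hflc _ hexp
    obtain ⟨m, hm⟩ := hexp.exists_pow_two_mul_norm_le
    exact (hSub.iterate m).finitelyManyLIClasses_of_two_mul_norm_le hflc hm
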